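/- arXiv:2211.14998 — 7 statements merged into one kernel-verified Lean document; each statement's English description precedes it below -/
import Mathlib

section
/- The fast informed bound (FIB) operator F is a γ-contraction mapping with respect to the sup norm: for all functions α, α' : S × A → ℝ, one has ‖Fα − Fα'‖_∞ ≤ γ‖α − α'‖_∞. -/
open Finset

/-- If two functions satisfy `f ≤ g + c` pointwise, then for a stochastic transition-observation
kernel `W` the summed maxima of their weighted averages differ by at most `c`. -/
theorem sum_sup'_weighted_le {S A Z : Type*} [Fintype S] [Fintype A] [Fintype Z] [Nonempty A]
    (W : S → Z → ℝ) (hW0 : ∀ s z, 0 ≤ W s z) (hWsum : ∑ z, ∑ s, W s z = 1)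
    (f g : S × A → ℝ) (c : ℝ) (hfg : ∀ x, f x ≤ g x + c) :
    ∑ z, univ.sup' univ_nonempty (fun a => ∑ s, W s z * f (s, a)) ≤
      ∑ z, univ.sup' univ_nonempty (fun a => ∑ s, W s z * g (s, a)) + c := by
  calc ∑ z, univ.sup' univ_nonempty (fun a => ∑ s, W s z * f (s, a))
      ≤ ∑ z, (univ.sup' univ_nonempty (fun a => ∑ s, W s z * g (s, a)) + (∑ s, W s z) * c) := by
        refine sum_le_sum fun z _ => sup'_le _ _ fun a _ => ?_
        calc ∑ s, W s z * f (s, a) ≤ ∑ s, W s z * (g (s, a) + c) :=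
              sum_le_sum fun s _ => mul_le_mul_of_nonneg_left (hfg _) (hW0 s z)
          _ = ∑ s, W s z * g (s, a) + (∑ s, W s z) * c := by
              simp only [mul_add, sum_add_distrib, sum_mul]
          _ ≤ _ := by
              gcongr
              exact le_sup' (fun a => ∑ s, W s z * g (s, a)) (mem_univ a)
    _ = _ := by rw [sum_add_distrib, ← sum_mul, hWsum, one_mul]

/-- The fast informed bound (FIB) operator `F` is a `γ`-contraction with respect to
the sup norm. -/
theorem fib_contraction
    {S A Z : Type*} [Fintype S] [Fintype A] [Fintype Z]
    [Nonempty S] [Nonempty A] [Nonempty Z]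
    (T : S → A → S → ℝ)
    (hT0 : ∀ s a s', 0 ≤ T s a s') (hT1 : ∀ s a s', T s a s' ≤ 1)
    (hTsum : ∀ s a, ∑ s', T s a s' = 1)
    (O : S → A → Z → ℝ)
    (hO0 : ∀ s' a z, 0 ≤ O s' a z) (hO1 : ∀ s' a z, O s' a z ≤ 1)
    (hOsum : ∀ s' a, ∑ z, O s' a z = 1)
    (R : S → A → ℝ) (γ : ℝ) (hγ0 : 0 < γ) (hγ1 : γ < 1)
    (F : (S × A → ℝ) → (S × A → ℝ))
    (hF : ∀ α (s : S) (a : A), F α (s, a) =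
      R s a + γ * ∑ z, univ.sup' univ_nonempty
        (fun a' => ∑ s', T s a s' * O s' a z * α (s', a')))
    (α α' : S × A → ℝ) :
    ‖F α - F α'‖ ≤ γ * ‖α - α'‖ := by
  refine (pi_norm_le_iff_of_nonneg (by positivity)).2 ?_
  rintro ⟨s, a⟩
  have hWsum : ∑ z, ∑ s', T s a s' * O s' a z = 1 := by
    rw [sum_comm]
    simp only [← mul_sum, hOsum, mul_one, hTsum]
  have hdist : ∀ x, |α x - α' x| ≤ ‖α - α'‖ := fun x => norm_le_pi_norm (α - α') x
  have key := sum_sup'_weighted_le (A := A) (fun s' z => T s a s' * O s' a z)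
    (fun s' z => mul_nonneg (hT0 s a s') (hO0 s' a z)) hWsum
  have h₁ := key α α' ‖α - α'‖ fun x => by linarith [(abs_le.1 (hdist x)).2]
  have h₂ := key α' α ‖α - α'‖ fun x => by linarith [(abs_le.1 (hdist x)).1]
  rw [Pi.sub_apply, hF, hF, add_sub_add_left_eq_sub, ← mul_sub, Real.norm_eq_abs, abs_mul,
    abs_of_pos hγ0]
  refine mul_le_mul_of_nonneg_left (abs_le.2 ⟨?_, ?_⟩) hγ0.le <;> linarith
end

section
/- The soft FIB operator F_τ is a γ-contraction mapping with respect to the sup norm: for all functions α, α' : S × A → ℝ, one has ‖F_τα − F_τα'‖_∞ ≤ γ‖α − α'‖_∞. -/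
open Finset

/-- If `x ≤ y + c` pointwise, the scaled log-sum-exp of `x` exceeds that of `y` by at most `c`. -/
theorem mul_log_sum_exp_div_le_add {ι : Type*} [Fintype ι] [Nonempty ι] {τ : ℝ} (hτ : 0 < τ)
    {x y : ι → ℝ} {c : ℝ} (h : ∀ i, x i ≤ y i + c) :
    τ * Real.log (∑ i, Real.exp (x i / τ)) ≤ τ * Real.log (∑ i, Real.exp (y i / τ)) + c := by
  have hpos (w : ι → ℝ) : 0 < ∑ i, Real.exp (w i / τ) :=
    Finset.sum_pos (fun i _ => Real.exp_pos _) Finset.univ_nonempty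
  have hle : ∑ i, Real.exp (x i / τ) ≤ (∑ i, Real.exp (y i / τ)) * Real.exp (c / τ) := by
    rw [Finset.sum_mul]
    refine Finset.sum_le_sum fun i _ => ?_
    rw [← Real.exp_add, ← add_div]
    have := h i
    gcongr
  calc τ * Real.log (∑ i, Real.exp (x i / τ))
      ≤ τ * Real.log ((∑ i, Real.exp (y i / τ)) * Real.exp (c / τ)) :=
        mul_le_mul_of_nonneg_left (Real.log_le_log (hpos x) hle) hτ.le
    _ = τ * Real.log (∑ i, Real.exp (y i / τ)) + c := by
        rw [Real.log_mul (hpos y).ne' (Real.exp_pos _).ne', Real.log_exp, mul_add,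
          mul_div_cancel₀ c hτ.ne']

/-- The soft FIB operator `F_τ` is a `γ`-contraction with respect to the sup norm. -/
theorem soft_fib_contraction
    {S A Z : Type*} [Fintype S] [Fintype A] [Fintype Z]
    [Nonempty S] [Nonempty A] [Nonempty Z]
    (T : S → A → S → ℝ)
    (hT0 : ∀ s a s', 0 ≤ T s a s') (hT1 : ∀ s a s', T s a s' ≤ 1)
    (hTsum : ∀ s a, ∑ s', T s a s' = 1)
    (O : S → A → Z → ℝ)
    (hO0 : ∀ s' a z, 0 ≤ O s' a z) (hO1 : ∀ s' a z, O s' a z ≤ 1)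
    (hOsum : ∀ s' a, ∑ z, O s' a z = 1)
    (R : S → A → ℝ) (γ : ℝ) (hγ0 : 0 < γ) (hγ1 : γ < 1)
    (τ : ℝ) (hτ : 0 < τ)
    (Fτ : (S × A → ℝ) → (S × A → ℝ))
    (hFτ : ∀ α (s : S) (a : A), Fτ α (s, a) =
      R s a + γ * ∑ z, τ * Real.log (∑ a',
        Real.exp ((∑ s', T s a s' * O s' a z * α (s', a')) / τ)))
    (α α' : S × A → ℝ) :
    ‖Fτ α - Fτ α'‖ ≤ γ * ‖α - α'‖ := by
  have hmass (s : S) (a : A) : ∑ z, ∑ s', T s a s' * O s' a z = 1 := by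
    rw [Finset.sum_comm]
    simp_rw [← Finset.mul_sum, hOsum, mul_one, hTsum]
  have key (β β' : S × A → ℝ) (s : S) (a : A) :
      Fτ β (s, a) - Fτ β' (s, a) ≤ γ * ‖β - β'‖ := by
    have hz (z : Z) :
        τ * Real.log (∑ a', Real.exp ((∑ s', T s a s' * O s' a z * β (s', a')) / τ)) ≤
          τ * Real.log (∑ a', Real.exp ((∑ s', T s a s' * O s' a z * β' (s', a')) / τ)) +
            (∑ s', T s a s' * O s' a z) * ‖β - β'‖ := by
      refine mul_log_sum_exp_div_le_add hτ fun a' => ?_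
      rw [Finset.sum_mul, ← Finset.sum_add_distrib]
      refine Finset.sum_le_sum fun s' _ => ?_
      have hβ : β (s', a') ≤ β' (s', a') + ‖β - β'‖ := by
        have := (le_abs_self _).trans (norm_le_pi_norm (β - β') (s', a'))
        simp only [Pi.sub_apply] at this
        linarith
      rw [← mul_add]
      exact mul_le_mul_of_nonneg_left hβ (mul_nonneg (hT0 s a s') (hO0 s' a z))
    have hsum := Finset.sum_le_sum fun z (_ : z ∈ Finset.univ) => hz z
    rw [Finset.sum_add_distrib, ← Finset.sum_mul, hmass, one_mul] at hsum
    have := mul_le_mul_of_nonneg_left hsum hγ0.le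
    rw [hFτ, hFτ]
    linarith
  refine (pi_norm_le_iff_of_nonneg (by positivity)).2 fun ⟨s, a⟩ => ?_
  rw [Pi.sub_apply, Real.norm_eq_abs, abs_sub_le_iff]
  exact ⟨key α α' s a, norm_sub_rev α α' ▸ key α' α s a⟩
end

section
/- For every integer n ≥ 1, every function α : S × A → ℝ, and every (s,a) ∈ S × A, the n-fold iterates of the QMDP and soft QMDP operators satisfy (F_τ^n α)(s,a) ≤ (F^n α)(s,a) + (γ + γ² + ⋯ + γⁿ) τ ln|A|. -/
open Finset

/-- The scaled log-sum-exp of values bounded by `M` is at most `M + τ log |A|`. -/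
theorem mul_log_sum_exp_div_le {A : Type*} [Fintype A] [Nonempty A] {τ : ℝ} (hτ : 0 < τ)
    (f : A → ℝ) {M : ℝ} (hf : ∀ a, f a ≤ M) :
    τ * Real.log (∑ a, Real.exp (f a / τ)) ≤ M + τ * Real.log (Fintype.card A) := by
  have hsum : ∑ a, Real.exp (f a / τ) ≤ Fintype.card A * Real.exp (M / τ) := by
    calc ∑ a, Real.exp (f a / τ) ≤ ∑ _a : A, Real.exp (M / τ) :=
          sum_le_sum fun a _ => Real.exp_le_exp.2 (div_le_div_of_nonneg_right (hf a) hτ.le)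
      _ = Fintype.card A * Real.exp (M / τ) := by simp
  have hpos : 0 < ∑ a, Real.exp (f a / τ) :=
    sum_pos (fun a _ => Real.exp_pos _) univ_nonempty
  have hcard : (Fintype.card A : ℝ) ≠ 0 := by exact_mod_cast Fintype.card_ne_zero
  calc τ * Real.log (∑ a, Real.exp (f a / τ))
      ≤ τ * Real.log (Fintype.card A * Real.exp (M / τ)) :=
        mul_le_mul_of_nonneg_left (Real.log_le_log hpos hsum) hτ.le
    _ = M + τ * Real.log (Fintype.card A) := by
        rw [Real.log_mul hcard (Real.exp_ne_zero _), Real.log_exp]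
        field_simp
        ring

theorem sum_Icc_one_succ_pow (x : ℝ) (n : ℕ) :
    ∑ i ∈ Icc 1 (n + 1), x ^ i = x * (∑ i ∈ Icc 1 n, x ^ i + 1) := by
  induction n with
  | zero => simp
  | succ k ih =>
    have h := sum_Icc_succ_top (show 1 ≤ k + 1 by omega) (fun i => x ^ i)
    rw [sum_Icc_succ_top (by omega)]
    linear_combination ih - x * h

/-- For every `n ≥ 1`, the `n`-fold iterates of the QMDP and soft QMDP operators
satisfy `(F_τ^n α)(s,a) ≤ (F^n α)(s,a) + (γ + γ² + ⋯ + γⁿ) τ ln |A|`. -/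
theorem qmdp_soft_qmdp_iterate_bound
    {S A : Type*} [Fintype S] [Fintype A] [Nonempty S] [Nonempty A]
    (T : S → A → S → ℝ)
    (hT0 : ∀ s a s', 0 ≤ T s a s') (hT1 : ∀ s a s', T s a s' ≤ 1)
    (hTsum : ∀ s a, ∑ s', T s a s' = 1)
    (R : S → A → ℝ) (γ : ℝ) (hγ0 : 0 < γ) (hγ1 : γ < 1)
    (τ : ℝ) (hτ : 0 < τ)
    (F : (S × A → ℝ) → (S × A → ℝ))
    (hF : ∀ α (s : S) (a : A), F α (s, a) =
      R s a + γ * ∑ s', T s a s' * (univ.sup' univ_nonempty (fun a' => α (s', a'))))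
    (Fτ : (S × A → ℝ) → (S × A → ℝ))
    (hFτ : ∀ α (s : S) (a : A), Fτ α (s, a) =
      R s a + γ * ∑ s', T s a s' * (τ * Real.log (∑ a', Real.exp (α (s', a') / τ))))
    (n : ℕ) (hn : 1 ≤ n) (α : S × A → ℝ) (s : S) (a : A) :
    Fτ^[n] α (s, a) ≤
      F^[n] α (s, a) + (∑ i ∈ Finset.Icc 1 n, γ ^ i) * (τ * Real.log (Fintype.card A)) := by
  clear hn
  induction n generalizing s a with
  | zero => simp
  | succ n ih =>
    set L := τ * Real.log (Fintype.card A)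
    set c := ∑ i ∈ Icc 1 n, γ ^ i with hc
    rw [Function.iterate_succ_apply', Function.iterate_succ_apply', hFτ, hF,
      sum_Icc_one_succ_pow, ← hc]
    set y := F^[n] α
    set x := Fτ^[n] α
    have hstep : ∀ s', τ * Real.log (∑ a', Real.exp (x (s', a') / τ)) ≤
        univ.sup' univ_nonempty (fun a' => y (s', a')) + (c + 1) * L := by
      intro s'
      have h := mul_log_sum_exp_div_le hτ (fun a' => x (s', a'))
        (M := univ.sup' univ_nonempty (fun a' => y (s', a')) + c * L) fun a' =>
          (ih s' a').trans <| by
            gcongr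
            exact le_sup' (fun a' => y (s', a')) (mem_univ a')
      linarith
    have hsum := sum_le_sum fun s' (_ : s' ∈ univ) =>
      mul_le_mul_of_nonneg_left (hstep s') (hT0 s a s')
    simp only [mul_add (T s a _), sum_add_distrib] at hsum
    rw [← sum_mul, hTsum, one_mul] at hsum
    have := mul_le_mul_of_nonneg_left hsum hγ0.le
    linarith
end

section
/- Let α* and α*_τ be the fixed points of the QMDP operator F and the soft QMDP operator F_τ, and define the approximate value functions V̄(b) = max_{a∈A} Σ_{s∈S} b(s) α*(s,a) and V̄_τ(b) = max_{a∈A} Σ_{s∈S} b(s) α*_τ(s,a) on the belief simplex B. Then for every belief b ∈ B, V̄(b) ≤ V̄_τ(b) ≤ V̄(b) + γτ ln|A| / (1 − γ). -/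
open Finset

section

variable {ι : Type*} [Fintype ι] [Nonempty ι]

theorem sup'_le_mul_log_sum_exp {τ : ℝ} (hτ : 0 < τ) (f : ι → ℝ) :
    univ.sup' univ_nonempty f ≤ τ * Real.log (∑ i, Real.exp (f i / τ)) := by
  refine sup'_le _ _ fun i _ => ?_
  have hle : Real.exp (f i / τ) ≤ ∑ j, Real.exp (f j / τ) :=
    single_le_sum (f := fun j => Real.exp (f j / τ)) (fun j _ => (Real.exp_pos _).le) (mem_univ i)
  have hlog := Real.log_le_log (Real.exp_pos _) hle
  rw [Real.log_exp, div_le_iff₀ hτ] at hlog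
  linarith

theorem mul_log_sum_exp_le_sup'_add {τ : ℝ} (hτ : 0 < τ) (f : ι → ℝ) :
    τ * Real.log (∑ i, Real.exp (f i / τ)) ≤
      univ.sup' univ_nonempty f + τ * Real.log (Fintype.card ι) := by
  set m := univ.sup' univ_nonempty f
  have hle : ∑ i, Real.exp (f i / τ) ≤ Fintype.card ι * Real.exp (m / τ) := by
    have h := sum_le_card_nsmul univ (fun i => Real.exp (f i / τ)) (Real.exp (m / τ)) fun i _ =>
      Real.exp_le_exp.2 (div_le_div_of_nonneg_right (le_sup' f (mem_univ i)) hτ.le)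
    simpa using h
  have hpos : 0 < ∑ i, Real.exp (f i / τ) :=
    sum_pos (fun i _ => Real.exp_pos _) univ_nonempty
  have hcard : (Fintype.card ι : ℝ) ≠ 0 := Nat.cast_ne_zero.2 Fintype.card_ne_zero
  have hlog := Real.log_le_log hpos hle
  rw [Real.log_mul hcard (Real.exp_ne_zero _), Real.log_exp] at hlog
  calc τ * Real.log (∑ i, Real.exp (f i / τ))
      ≤ τ * (Real.log (Fintype.card ι) + m / τ) := mul_le_mul_of_nonneg_left hlog hτ.le
    _ = m + τ * Real.log (Fintype.card ι) := by field_simp; ring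

theorem sup'_le_sup'_add {f g : ι → ℝ} {M : ℝ} (h : ∀ i, f i ≤ g i + M) :
    univ.sup' univ_nonempty f ≤ univ.sup' univ_nonempty g + M :=
  sup'_le _ _ fun i _ => (h i).trans (by gcongr; exact le_sup' g (mem_univ i))

/-- If every uniform bound `M` on `u - v` improves to `c + γ * M` with `γ < 1`, then `u - v` is
bounded by `c / (1 - γ)`. -/
theorem le_add_div_one_sub_of_improve {u v : ι → ℝ} {γ c : ℝ} (hγ : γ < 1)
    (h : ∀ M, (∀ i, u i ≤ v i + M) → ∀ i, u i ≤ v i + (c + γ * M)) (i : ι) :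
    u i ≤ v i + c / (1 - γ) := by
  obtain ⟨j, hj⟩ := Finite.exists_max fun i => u i - v i
  have hbound := h (u j - v j) (fun i => by linarith [hj i]) j
  have hmax : u j - v j ≤ c / (1 - γ) := by
    rw [le_div_iff₀ (by linarith)]
    linarith
  linarith [hj i]

end

theorem sum_mul_le_sum_mul_add {ι : Type*} [Fintype ι] {w f g : ι → ℝ} {M : ℝ}
    (hw : ∀ i, 0 ≤ w i) (hsum : ∑ i, w i = 1) (h : ∀ i, f i ≤ g i + M) :
    ∑ i, w i * f i ≤ ∑ i, w i * g i + M := by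
  calc ∑ i, w i * f i ≤ ∑ i, w i * (g i + M) :=
        sum_le_sum fun i _ => mul_le_mul_of_nonneg_left (h i) (hw i)
    _ = ∑ i, w i * g i + M := by simp only [mul_add, sum_add_distrib, ← sum_mul, hsum, one_mul]

/-- Let `α*` and `α*_τ` be fixed points of the QMDP operator `F` and the soft QMDP
operator `F_τ`, and define the approximate value functions
`V̄(b) = max_a ∑_s b s * α*(s,a)` and `V̄_τ(b) = max_a ∑_s b s * α*_τ(s,a)`.
Then for every belief `b` in the simplex, `V̄(b) ≤ V̄_τ(b) ≤ V̄(b) + γτ ln|A| / (1−γ)`. -/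
theorem qmdp_soft_qmdp_value_bound
    {S A : Type*} [Fintype S] [Fintype A] [Nonempty S] [Nonempty A]
    (T : S → A → S → ℝ)
    (hT0 : ∀ s a s', 0 ≤ T s a s') (hT1 : ∀ s a s', T s a s' ≤ 1)
    (hTsum : ∀ s a, ∑ s', T s a s' = 1)
    (R : S → A → ℝ) (γ : ℝ) (hγ0 : 0 < γ) (hγ1 : γ < 1)
    (τ : ℝ) (hτ : 0 < τ)
    (F : (S × A → ℝ) → (S × A → ℝ))
    (hF : ∀ α (s : S) (a : A), F α (s, a) =
      R s a + γ * ∑ s', T s a s' * (univ.sup' univ_nonempty (fun a' => α (s', a'))))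
    (Fτ : (S × A → ℝ) → (S × A → ℝ))
    (hFτ : ∀ α (s : S) (a : A), Fτ α (s, a) =
      R s a + γ * ∑ s', T s a s' * (τ * Real.log (∑ a', Real.exp (α (s', a') / τ))))
    (αstar αstarτ : S × A → ℝ)
    (hstar : F αstar = αstar) (hstarτ : Fτ αstarτ = αstarτ)
    (Vbar Vbarτ : (S → ℝ) → ℝ)
    (hV : ∀ b : S → ℝ, Vbar b = univ.sup' univ_nonempty (fun a => ∑ s, b s * αstar (s, a)))
    (hVτ : ∀ b : S → ℝ, Vbarτ b = univ.sup' univ_nonempty (fun a => ∑ s, b s * αstarτ (s, a)))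
    (b : S → ℝ) (hb0 : ∀ s, 0 ≤ b s) (hb1 : ∀ s, b s ≤ 1) (hbsum : ∑ s, b s = 1) :
    Vbar b ≤ Vbarτ b ∧
    Vbarτ b ≤ Vbar b + γ * τ * Real.log (Fintype.card A) / (1 - γ) := by
  have hα (s : S) (a : A) := (congrFun hstar (s, a)).symm.trans (hF αstar s a)
  have hατ (s : S) (a : A) := (congrFun hstarτ (s, a)).symm.trans (hFτ αstarτ s a)
  have hlower : ∀ p, αstar p ≤ αstarτ p + 0 / (1 - γ) := by
    refine le_add_div_one_sub_of_improve hγ1 fun M hM => ?_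
    rintro ⟨s, a⟩
    have hstep := sum_mul_le_sum_mul_add (hT0 s a) (hTsum s a) fun s' =>
      (sup'_le_sup'_add fun a' => hM (s', a')).trans
        (add_le_add_left (sup'_le_mul_log_sum_exp hτ fun a' => αstarτ (s', a')) M)
    rw [hα, hατ]
    linarith [mul_le_mul_of_nonneg_left hstep hγ0.le]
  have hupper : ∀ p, αstarτ p ≤ αstar p + γ * τ * Real.log (Fintype.card A) / (1 - γ) := by
    refine le_add_div_one_sub_of_improve hγ1 fun M hM => ?_
    rintro ⟨s, a⟩
    have hstep := sum_mul_le_sum_mul_add (M := M + τ * Real.log (Fintype.card A))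
      (hT0 s a) (hTsum s a) fun s' =>
      ((mul_log_sum_exp_le_sup'_add hτ fun a' => αstarτ (s', a')).trans
        (add_le_add_left (sup'_le_sup'_add fun a' => hM (s', a')) _)).trans_eq (add_assoc _ _ _)
    rw [hα, hατ]
    linarith [mul_le_mul_of_nonneg_left hstep hγ0.le]
  rw [hV, hVτ]
  constructor
  · simpa using sup'_le_sup'_add fun a => sum_mul_le_sum_mul_add hb0 hbsum fun s => hlower (s, a)
  · exact sup'_le_sup'_add fun a => sum_mul_le_sum_mul_add hb0 hbsum fun s => hupper (s, a)
end

section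
/- Let F : ℝ^N → ℝ^N be a γ-contraction with respect to the sup norm (γ ∈ (0,1)) and let η > 0. Let α ∈ ℝ^N with residual g = α − F(α), let A ∈ ℝ^{N×N} be a matrix with spectral norm ‖A‖₂ ≤ 1 + 2/η, and set α' = α − A g with residual g' = α' − F(α'). Then ‖g'‖_∞ ≤ (1 + (1 + γ)√N (1 + 2/η)) ‖g‖_∞. -/
/-- The sup norm on `ℝ^ι` is at most the Euclidean norm. -/
theorem pi_norm_le_sqrt_sum_sq {ι : Type*} [Fintype ι] (x : ι → ℝ) :
    ‖x‖ ≤ Real.sqrt (∑ i, x i ^ 2) := by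
  refine (pi_norm_le_iff_of_nonneg (Real.sqrt_nonneg _)).2 fun i => ?_
  rw [Real.norm_eq_abs]
  exact Real.abs_le_sqrt
    (Finset.single_le_sum (f := fun j => x j ^ 2) (fun j _ => sq_nonneg _) (Finset.mem_univ i))

/-- The Euclidean norm on `ℝ^ι` is at most `√(card ι)` times the sup norm. -/
theorem sqrt_sum_sq_le_sqrt_card_mul_pi_norm {ι : Type*} [Fintype ι] (x : ι → ℝ) :
    Real.sqrt (∑ i, x i ^ 2) ≤ Real.sqrt (Fintype.card ι) * ‖x‖ := by
  refine Real.sqrt_le_iff.2 ⟨by positivity, ?_⟩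
  rw [mul_pow, Real.sq_sqrt (Nat.cast_nonneg _)]
  calc ∑ i, x i ^ 2 ≤ ∑ _i : ι, ‖x‖ ^ 2 := Finset.sum_le_sum fun i _ => by
        rw [← sq_abs, ← Real.norm_eq_abs]
        exact pow_le_pow_left₀ (norm_nonneg _) (norm_le_pi_norm x i) 2
    _ = Fintype.card ι * ‖x‖ ^ 2 := by simp

/-- One step of (regularized) Anderson acceleration `α' = α − A g`, where the matrix
`A` has spectral norm at most `1 + 2/η`, increases the sup-norm residual of a
`γ`-contraction `F` by at most the factor `1 + (1 + γ)√N (1 + 2/η)`. -/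
theorem aa_step_residual_bound
    (N : ℕ) (hN : 1 ≤ N)
    (F : (Fin N → ℝ) → (Fin N → ℝ)) (γ : ℝ) (hγ0 : 0 < γ) (hγ1 : γ < 1)
    (hF : ∀ x y : Fin N → ℝ, ‖F x - F y‖ ≤ γ * ‖x - y‖)
    (η : ℝ) (hη : 0 < η)
    (α : Fin N → ℝ) (g : Fin N → ℝ) (hg : g = α - F α)
    (A : Matrix (Fin N) (Fin N) ℝ)
    (hA : ∀ x : Fin N → ℝ,
      Real.sqrt (∑ i, (A.mulVec x i) ^ 2) ≤ (1 + 2 / η) * Real.sqrt (∑ i, (x i) ^ 2))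
    (α' : Fin N → ℝ) (hα' : α' = α - A.mulVec g)
    (g' : Fin N → ℝ) (hg' : g' = α' - F α') :
    ‖g'‖ ≤ (1 + (1 + γ) * Real.sqrt N * (1 + 2 / η)) * ‖g‖ := by
  have hAg : ‖A.mulVec g‖ ≤ (1 + 2 / η) * (Real.sqrt N * ‖g‖) := by
    have h := sqrt_sum_sq_le_sqrt_card_mul_pi_norm g
    rw [Fintype.card_fin] at h
    exact (pi_norm_le_sqrt_sum_sq _).trans
      ((hA g).trans (mul_le_mul_of_nonneg_left h (by positivity)))
  have hFα : ‖F α - F α'‖ ≤ γ * ‖A.mulVec g‖ := by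
    simpa [hα'] using hF α α'
  have hsplit : g' = g - A.mulVec g + (F α - F α') := by
    rw [hg', hg, hα', hg]
    abel
  calc ‖g'‖ ≤ ‖g‖ + ‖A.mulVec g‖ + γ * ‖A.mulVec g‖ := by
        rw [hsplit]
        exact (norm_add_le _ _).trans (add_le_add (norm_sub_le _ _) hFα)
    _ = ‖g‖ + (1 + γ) * ‖A.mulVec g‖ := by ring
    _ ≤ ‖g‖ + (1 + γ) * ((1 + 2 / η) * (Real.sqrt N * ‖g‖)) := by gcongr
    _ = (1 + (1 + γ) * Real.sqrt N * (1 + 2 / η)) * ‖g‖ := by ring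
end

section
/- (Convergence of safeguarded Anderson acceleration.) Let F : ℝ^N → ℝ^N be a γ-contraction with respect to the sup norm (γ ∈ (0,1)) with fixed point α*, and fix constants η > 0, an integer N_s ≥ 1, D > 0 and φ > 0. Let {α^k}_{k≥0} be a sequence in ℝ^N with residuals g^k = α^k − F(α^k), such that for every k one of the following holds: (i) α^{k+1} = F(α^k) (an FPI step), or (ii) ‖α^{k+1} − α^k‖_∞ ≤ √N (1 + 2/η) ‖g^k‖_∞ (an AA step). Suppose further that the AA steps occur in maximal runs of consecutive indices each of length at most N_s, and that whenever k_0 < k_1 < k_2 < ⋯ enumerate the starting indices of these runs, the residuals at the run starts satisfy ‖g^{k_i}‖_∞ ≤ D ‖g^0‖_∞ (i + 1)^{−(1+φ)} for every i. Then α^k converges to α*, i.e., lim_{k→∞} ‖α^k − α*‖_∞ = 0. -/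
/-- Along an alternation of expansion (`step k = true`, factor `L`) and contraction steps in
which expansion runs have length at most `n`, the error grows by at most `L ^ n` from a run start
until the next run start. -/
theorem error_le_of_last_runStart {e : ℕ → ℝ} {step : ℕ → Bool} {L : ℝ} {n s : ℕ}
    (he : ∀ k, 0 ≤ e k) (hL : 1 ≤ L)
    (hexp : ∀ k, step k = true → e (k + 1) ≤ L * e k)
    (hcon : ∀ k, step k = false → e (k + 1) ≤ e k)
    (hrun : ∃ j, s ≤ j ∧ j ≤ s + n ∧ step j = false) (m : ℕ)
    (hno : ∀ k, s ≤ k → k < s + m → step k = false → step (k + 1) = true → s + m < k + 1) :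
    e (s + m) ≤ L ^ n * e s := by
  obtain ⟨j, hsj, hjn, hj⟩ := hrun
  have hstep_pow : ∀ p, p ≤ n → L ^ p * e s ≤ L ^ n * e s := fun p hp =>
    mul_le_mul_of_nonneg_right (pow_le_pow_right₀ hL hp) (he s)
  have key : ∀ p, p ≤ m →
      ((∀ i < p, step (s + i) = true) ∧ e (s + p) ≤ L ^ p * e s) ∨
      (∃ q, p = q + 1 ∧ step (s + q) = false ∧ e (s + p) ≤ L ^ n * e s) := by
    intro p
    induction p with
    | zero => intro _; left; simp
    | succ p ih =>
      intro hp
      rcases ih (by omega) with ⟨hall, hle⟩ | ⟨q, rfl, hq, hle⟩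
      · have hpn : p ≤ n := by
          by_contra hlt
          have := hall (j - s) (by omega)
          rw [show s + (j - s) = j by omega, hj] at this
          exact absurd this (by simp)
        cases hs : step (s + p) with
        | false =>
          right
          exact ⟨p, rfl, hs, (hcon _ hs).trans (hle.trans (hstep_pow p hpn))⟩
        | true =>
          left
          refine ⟨fun i hi => ?_, ?_⟩
          · rcases Nat.lt_succ_iff_lt_or_eq.mp hi with h | rfl
            · exact hall i h
            · exact hs
          · calc e (s + p + 1) ≤ L * e (s + p) := hexp _ hs
              _ ≤ L * (L ^ p * e s) := by gcongr
              _ = L ^ (p + 1) * e s := by ring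
      · right
        have hs : step (s + (q + 1)) = false := by
          by_contra h
          have := hno (s + q) (by omega) (by omega) hq (by simpa [add_assoc] using h)
          omega
        exact ⟨q + 1, rfl, hs, (hcon _ hs).trans hle⟩
  rcases key m le_rfl with ⟨hall, hle⟩ | ⟨_, _, _, hle⟩
  · have hmn : m ≤ n := by
      by_contra hlt
      have := hall (j - s) (by omega)
      rw [show s + (j - s) = j by omega, hj] at this
      exact absurd this (by simp)
    exact hle.trans (hstep_pow m hmn)
  · exact hle

open Classical in
/-- Errors tend to zero when they contract off expansion runs of bounded length and are controlled
at the start of the `i`-th run by a null sequence `b i`. -/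
theorem tendsto_zero_of_safeguarded_runs {e b : ℕ → ℝ} {step : ℕ → Bool} {L γ : ℝ} {n : ℕ}
    (he : ∀ k, 0 ≤ e k) (hL : 1 ≤ L) (hγ0 : 0 ≤ γ) (hγ1 : γ < 1)
    (hexp : ∀ k, step k = true → e (k + 1) ≤ L * e k)
    (hcon : ∀ k, step k = false → e (k + 1) ≤ γ * e k)
    (hrun : ∀ k, ∃ j, k ≤ j ∧ j ≤ k + n ∧ step j = false)
    {R : ℕ → Prop} (hR : ∀ k, step k = false → step (k + 1) = true → R (k + 1))
    (hb : Filter.Tendsto b Filter.atTop (nhds 0))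
    (hRb : ∀ k, R k → e k ≤ b (Nat.count R k)) :
    Filter.Tendsto e Filter.atTop (nhds 0) := by
  have hcon' : ∀ k, step k = false → e (k + 1) ≤ e k := fun k hk =>
    (hcon k hk).trans (mul_le_of_le_one_left (he k) hγ1.le)
  by_cases hinf : {k | R k}.Infinite
  · rw [Metric.tendsto_atTop]
    intro ε hε
    have hb' : Filter.Tendsto (fun i => L ^ n * b i) Filter.atTop (nhds 0) := by
      simpa using hb.const_mul (L ^ n)
    obtain ⟨i₀, hi₀⟩ := Filter.eventually_atTop.mp (hb'.eventually_lt_const hε)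
    refine ⟨Nat.nth R i₀, fun k hk => ?_⟩
    have hR₀ : R (Nat.nth R i₀) := Nat.nth_mem_of_infinite hinf i₀
    set s := Nat.findGreatest R k with hs
    have hsR : R s := Nat.findGreatest_spec hk hR₀
    have hsk : s ≤ k := Nat.findGreatest_le k
    have hs₀ : Nat.nth R i₀ ≤ s := Nat.le_findGreatest hk hR₀
    have hcount : i₀ ≤ Nat.count R s := by
      simpa [Nat.count_nth_of_infinite hinf] using Nat.count_monotone R hs₀
    have hlast := error_le_of_last_runStart he hL hexp hcon' (hrun s) (k - s) (by
      intro l hl _ h0 h1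
      by_contra hle
      exact Nat.findGreatest_is_greatest (P := R) (n := k) (k := l + 1) (by omega) (by omega)
        (hR l h0 h1))
    rw [Nat.add_sub_cancel' hsk] at hlast
    rw [Real.dist_eq, sub_zero, abs_of_nonneg (he k)]
    calc e k ≤ L ^ n * e s := hlast
      _ ≤ L ^ n * b (Nat.count R s) := by
          have := hRb s hsR
          gcongr
      _ < ε := hi₀ _ hcount
  · obtain ⟨M, hM⟩ := (Set.not_infinite.mp hinf).bddAbove
    obtain ⟨j, hMj, -, hj⟩ := hrun M
    have hfalse : ∀ m, step (j + m) = false := by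
      intro m
      induction m with
      | zero => exact hj
      | succ m ih =>
        by_contra h
        have : j + m + 1 ≤ M := hM (hR (j + m) ih (by simpa [add_assoc] using h))
        omega
    have hgeo : ∀ m, e (m + j) ≤ γ ^ m * e j := by
      intro m
      induction m with
      | zero => simp
      | succ m ih =>
        have h := hcon (j + m) (hfalse m)
        rw [show m + 1 + j = j + m + 1 by ring]
        rw [add_comm m j] at ih
        calc e (j + m + 1) ≤ γ * e (j + m) := h
          _ ≤ γ * (γ ^ m * e j) := by gcongr
          _ = γ ^ (m + 1) * e j := by ring
    rw [← Filter.tendsto_add_atTop_iff_nat j]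
    refine squeeze_zero (fun m => he _) hgeo ?_
    simpa using (tendsto_pow_atTop_nhds_zero_of_lt_one hγ0 hγ1).mul_const (e j)

/-- Convergence of safeguarded Anderson acceleration. `F` is a `γ`-contraction with
respect to the sup norm with fixed point `α*`. The sequence `α^k` makes either FPI
steps (`step k = false`, `α^{k+1} = F(α^k)`) or AA steps (`step k = true`, with
update increment bounded by `√N (1 + 2/η) ‖g^k‖_∞`). AA steps occur in maximal runs
of consecutive indices of length at most `N_s` (i.e. among any `N_s + 1` consecutive
indices there is an FPI step), and at the starting index of the `i`-th run (a run
start is an AA index that is either `0` or preceded by an FPI index) the residual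
satisfies the safeguarding bound `‖g^{k_i}‖_∞ ≤ D ‖g^0‖_∞ (i + 1)^{−(1+φ)}`.
Then `‖α^k − α*‖_∞ → 0`. -/
theorem aa_safeguarded_convergence
    (N : ℕ) (hN : 1 ≤ N)
    (F : (Fin N → ℝ) → (Fin N → ℝ)) (γ : ℝ) (hγ0 : 0 < γ) (hγ1 : γ < 1)
    (hF : ∀ x y : Fin N → ℝ, ‖F x - F y‖ ≤ γ * ‖x - y‖)
    (αstar : Fin N → ℝ) (hfix : F αstar = αstar)
    (η : ℝ) (hη : 0 < η) (Ns : ℕ) (hNs : 1 ≤ Ns)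
    (D : ℝ) (hD : 0 < D) (φ : ℝ) (hφ : 0 < φ)
    (α : ℕ → Fin N → ℝ) (g : ℕ → Fin N → ℝ) (hg : ∀ k, g k = α k - F (α k))
    (step : ℕ → Bool)
    (hFPI : ∀ k, step k = false → α (k + 1) = F (α k))
    (hAA : ∀ k, step k = true →
      ‖α (k + 1) - α k‖ ≤ Real.sqrt N * (1 + 2 / η) * ‖g k‖)
    (hrun : ∀ k, ∃ j, k ≤ j ∧ j ≤ k + Ns ∧ step j = false)
    (runStart : ℕ → Prop)
    (hrunStart : ∀ k, runStart k ↔ (step k = true ∧ (k = 0 ∨ step (k - 1) = false)))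
    (hsafe : ∀ k, runStart k →
      ‖g k‖ ≤ D * ‖g 0‖ *
        ((Nat.card {j : ℕ // j < k ∧ runStart j} + 1 : ℝ) ^ (-(1 + φ) : ℝ))) :
    Filter.Tendsto (fun k => ‖α k - αstar‖) Filter.atTop (nhds 0) := by
  classical
  have hγ : 0 < 1 - γ := by linarith
  set C : ℝ := Real.sqrt N * (1 + 2 / η) with hC
  have hC0 : 0 ≤ C := by positivity
  have hcontr : ∀ k, ‖F (α k) - αstar‖ ≤ γ * ‖α k - αstar‖ := fun k => by
    simpa [hfix] using hF (α k) αstar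
  have hg_le : ∀ k, ‖g k‖ ≤ (1 + γ) * ‖α k - αstar‖ := fun k => by
    have h : g k = (α k - αstar) - (F (α k) - αstar) := by rw [hg]; abel
    have := norm_sub_le (α k - αstar) (F (α k) - αstar)
    rw [← h] at this
    linarith [hcontr k]
  have herr_le : ∀ k, ‖α k - αstar‖ ≤ ‖g k‖ / (1 - γ) := fun k => by
    have h : α k - αstar = g k + (F (α k) - αstar) := by rw [hg]; abel
    have := norm_add_le (g k) (F (α k) - αstar)
    rw [← h] at this
    rw [le_div_iff₀ hγ]
    linarith [hcontr k]
  refine tendsto_zero_of_safeguarded_runs (step := step) (L := 1 + C * (1 + γ)) (γ := γ) (n := Ns)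
    (R := runStart)
    (b := fun i => D * ‖g 0‖ * ((i + 1 : ℝ) ^ (-(1 + φ) : ℝ)) / (1 - γ))
    (fun k => norm_nonneg _) ?_ hγ0.le hγ1 ?_ ?_ hrun ?_ ?_ ?_
  · have : 0 ≤ C * (1 + γ) := by positivity
    linarith
  · intro k hk
    have h : α (k + 1) - αstar = (α (k + 1) - α k) + (α k - αstar) := by abel
    have h1 := norm_add_le (α (k + 1) - α k) (α k - αstar)
    rw [← h] at h1
    have h2 := mul_le_mul_of_nonneg_left (hg_le k) hC0
    linarith [hAA k hk]
  · intro k hk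
    rw [hFPI k hk]
    exact hcontr k
  · intro k h0 h1
    exact (hrunStart _).mpr ⟨h1, Or.inr (by simpa using h0)⟩
  · have h := (tendsto_rpow_neg_atTop (show 0 < 1 + φ by linarith)).comp
      (Filter.tendsto_atTop_add_const_right _ (1 : ℝ) tendsto_natCast_atTop_atTop)
    simpa using (h.const_mul (D * ‖g 0‖)).div_const (1 - γ)
  · intro k hk
    have hcard : Nat.card {j : ℕ // j < k ∧ runStart j} = Nat.count runStart k := by
      let _ := Nat.CountSet.fintype runStart k
      rw [Nat.count_eq_card_fintype, Nat.card_eq_fintype_card]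
    have h := hsafe k hk
    rw [hcard] at h
    exact (herr_le k).trans (by gcongr)
end

section
/- (Error bound for inexact fixed-point iteration.) Let F : ℝ^N → ℝ^N be a γ-contraction with respect to the sup norm (γ ∈ (0,1)) with fixed point α*, and let ε > 0. Let {α^k}_{k≥0} be a sequence in ℝ^N satisfying α^{k+1} = F(α^k) + e^k with ‖e^k‖_∞ ≤ ε for all k. Then the residuals G(α^k) = α^k − F(α^k) satisfy liminf_{k→∞} ‖G(α^k)‖_∞ ≤ (1 + γ)/(1 − γ) · ε. -/
theorem le_geometric_add_of_succ_le {γ ε : ℝ} (hγ0 : 0 ≤ γ) (hγ1 : γ < 1) (hε : 0 ≤ ε)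
    {d : ℕ → ℝ} (hd : ∀ k, d (k + 1) ≤ γ * d k + ε) (k : ℕ) :
    d k ≤ γ ^ k * d 0 + ε / (1 - γ) := by
  have hpos : 0 < 1 - γ := sub_pos.2 hγ1
  induction k with
  | zero => simpa using div_nonneg hε hpos.le
  | succ k ih =>
    calc d (k + 1) ≤ γ * (γ ^ k * d 0 + ε / (1 - γ)) + ε :=
          (hd k).trans (by gcongr)
      _ = γ ^ (k + 1) * d 0 + ε / (1 - γ) := by
          field_simp
          ring

theorem norm_sub_map_le_of_fixed {E : Type*} [SeminormedAddCommGroup E] {F : E → E} {γ : ℝ}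
    (hF : ∀ x y, ‖F x - F y‖ ≤ γ * ‖x - y‖) {p : E} (hp : F p = p) (x : E) :
    ‖x - F x‖ ≤ (1 + γ) * ‖x - p‖ := by
  have hFx := hF p x
  rw [hp, norm_sub_rev p x] at hFx
  linarith [norm_sub_le_norm_sub_add_norm_sub x p (F x)]

/-- Error bound for inexact fixed-point iteration: if `α^{k+1} = F(α^k) + e^k` with
`‖e^k‖_∞ ≤ ε`, where `F` is a `γ`-contraction with respect to the sup norm with
fixed point `α*`, then `liminf_k ‖G(α^k)‖_∞ ≤ (1 + γ)/(1 − γ) · ε`, where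
`G(α) = α − F(α)` is the residual. -/
theorem inexact_fpi_residual_bound
    (N : ℕ) (hN : 1 ≤ N)
    (F : (Fin N → ℝ) → (Fin N → ℝ)) (γ : ℝ) (hγ0 : 0 < γ) (hγ1 : γ < 1)
    (hF : ∀ x y : Fin N → ℝ, ‖F x - F y‖ ≤ γ * ‖x - y‖)
    (αstar : Fin N → ℝ) (hfix : F αstar = αstar)
    (ε : ℝ) (hε : 0 < ε)
    (α : ℕ → Fin N → ℝ) (e : ℕ → Fin N → ℝ)
    (hstep : ∀ k, α (k + 1) = F (α k) + e k)
    (he : ∀ k, ‖e k‖ ≤ ε)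
    (G : (Fin N → ℝ) → (Fin N → ℝ)) (hG : ∀ x, G x = x - F x) :
    Filter.liminf (fun k => ‖G (α k)‖) Filter.atTop ≤ (1 + γ) / (1 - γ) * ε := by
  have hd : ∀ k, ‖α (k + 1) - αstar‖ ≤ γ * ‖α k - αstar‖ + ε := fun k => by
    have hF' := hF (α k) αstar
    rw [hfix] at hF'
    rw [hstep, add_sub_right_comm]
    exact (norm_add_le _ _).trans (add_le_add hF' (he k))
  have hr : ∀ k, ‖G (α k)‖ ≤ (1 + γ) * (γ ^ k * ‖α 0 - αstar‖ + ε / (1 - γ)) := fun k => by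
    rw [hG]
    refine (norm_sub_map_le_of_fixed hF hfix _).trans ?_
    gcongr
    exact le_geometric_add_of_succ_le (d := fun k => ‖α k - αstar‖) hγ0.le hγ1 hε.le hd k
  have hlim : Filter.Tendsto (fun k => (1 + γ) * (γ ^ k * ‖α 0 - αstar‖ + ε / (1 - γ)))
      Filter.atTop (nhds ((1 + γ) / (1 - γ) * ε)) := by
    have h := (((tendsto_pow_atTop_nhds_zero_of_lt_one hγ0.le hγ1).mul_const
      ‖α 0 - αstar‖).add_const (ε / (1 - γ))).const_mul (1 + γ)
    rwa [zero_mul, zero_add, mul_div_left_comm, mul_comm ε] at h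
  rw [← hlim.liminf_eq]
  exact Filter.liminf_le_liminf (Filter.Eventually.of_forall hr)
    (Filter.isBoundedUnder_of ⟨0, fun k => norm_nonneg _⟩) hlim.isCoboundedUnder_ge
end
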